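/- Let A be a unital C*-algebra, let (ρ_k)_{k∈ℕ} be a sequence of continuous linear functionals on A such that ρ_{k+1} − ρ_k is positive for every k, and let ρ be a continuous linear functional on A such that ρ_k(x) → ρ(x) as k → ∞ for every x ∈ A. Then ρ − ρ_k is positive for every k, and ‖ρ − ρ_k‖ → 0 as k → ∞. -/

import Mathlib

open scoped ComplexOrder

section PositiveFunctional

open scoped ComplexStarModule

variable {A : Type*} [CStarAlgebra A] [PartialOrder A] [StarOrderedRing A]

/-- A positive linear functional is real on self-adjoint elements, where it is bounded by its
value at `1`. -/
lemma im_eq_zero_and_abs_re_le_of_isSelfAdjoint (ω : A →ₗ[ℂ] ℂ)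
    (hω : ∀ a : A, 0 ≤ a → 0 ≤ ω a) {x : A} (hx : IsSelfAdjoint x) :
    (ω x).im = 0 ∧ |(ω x).re| ≤ (ω 1).re * ‖x‖ := by
  have h_one := hω 1 zero_le_one
  have h_sub := hω _ (sub_nonneg.2 hx.le_algebraMap_norm_self)
  have h_add := hω _ (neg_le_iff_add_nonneg.1 hx.neg_algebraMap_norm_le_self)
  have h_alg : ω (algebraMap ℝ A ‖x‖) = (‖x‖ : ℂ) * ω 1 := by
    rw [Algebra.algebraMap_eq_smul_one, ← Complex.coe_smul, map_smul, smul_eq_mul]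
  rw [map_sub, h_alg] at h_sub
  rw [map_add, h_alg] at h_add
  simp only [Complex.nonneg_iff, Complex.sub_re, Complex.sub_im, Complex.add_re, Complex.add_im,
    Complex.re_ofReal_mul, Complex.im_ofReal_mul] at h_one h_sub h_add
  rw [← h_one.2] at h_sub
  refine ⟨by linarith, abs_le.2 ⟨by linarith, by linarith⟩⟩

/-- A positive continuous linear functional `ω` satisfies `‖ω‖ ≤ ω 1`. -/
lemma ContinuousLinearMap.opNorm_le_re_apply_one_of_nonneg (ω : A →L[ℂ] ℂ)
    (hω : ∀ a : A, 0 ≤ a → 0 ≤ ω a) : ‖ω‖ ≤ (ω 1).re := by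
  refine ω.opNorm_le_bound (Complex.nonneg_iff.1 (hω 1 zero_le_one)).1 fun a => ?_
  obtain ⟨c, hc, hca⟩ := Complex.exists_norm_eq_mul_self (ω a)
  set b : A := c • a
  have hb : ω b = (‖ω a‖ : ℂ) := by rw [map_smul, smul_eq_mul, hca]
  have hb_norm : ‖b‖ = ‖a‖ := by simp [b, norm_smul, hc]
  have h_im := (im_eq_zero_and_abs_re_le_of_isSelfAdjoint ω.toLinearMap hω (ℑ b).2).1
  have h_re := (im_eq_zero_and_abs_re_le_of_isSelfAdjoint ω.toLinearMap hω (ℜ b).2).2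
  have h_eq : ‖ω a‖ = (ω (ℜ b : A)).re := by
    have h := congrArg (fun y => (ω y).re) (realPart_add_I_smul_imaginaryPart b)
    simp only [map_add, map_smul, hb] at h
    simpa [show (ω (ℑ b : A)).im = 0 from h_im] using h.symm
  calc ‖ω a‖ ≤ (ω 1).re * ‖(ℜ b : A)‖ := h_eq ▸ (le_abs_self _).trans h_re
    _ ≤ (ω 1).re * ‖a‖ := by
      rw [← hb_norm]
      exact mul_le_mul_of_nonneg_left (realPart.norm_le b)
        (Complex.nonneg_iff.1 (hω 1 zero_le_one)).1

end PositiveFunctional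



/-- **Lemma 4.5.** If `(ρ_k)` is an increasing sequence of continuous linear functionals on a
unital C*-algebra converging pointwise (weak*) to a continuous linear functional `ρ`, then each
`ρ - ρ_k` is positive and `‖ρ - ρ_k‖ → 0`. -/
theorem tendsto_norm_sub_of_monotone_of_weakStar_tendsto
    {A : Type*} [NormedRing A] [StarRing A] [CStarRing A] [NormedAlgebra ℂ A]
    [StarModule ℂ A] [PartialOrder A] [StarOrderedRing A] [CompleteSpace A]
    (ρ : ℕ → (A →L[ℂ] ℂ)) (ρ' : A →L[ℂ] ℂ)
    (hmono : ∀ k, ∀ a : A, 0 ≤ a → 0 ≤ (ρ (k + 1) - ρ k) a)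
    (hconv : ∀ x : A, Filter.Tendsto (fun k => ρ k x) Filter.atTop (nhds (ρ' x))) :
    (∀ k, ∀ a : A, 0 ≤ a → 0 ≤ (ρ' - ρ k) a) ∧
    Filter.Tendsto (fun k => ‖ρ' - ρ k‖) Filter.atTop (nhds 0) := by
  have hpos : ∀ k, ∀ a : A, 0 ≤ a → 0 ≤ (ρ' - ρ k) a := fun k a ha => by
    have h_mono : Monotone fun j => ρ j a :=
      monotone_nat_of_le_succ fun j => sub_nonneg.1 (hmono j a ha)
    exact sub_nonneg.2 (h_mono.ge_of_tendsto (hconv a) k)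
  refine ⟨hpos, ?_⟩
  let _ : CStarAlgebra A := {}
  have h_one : Filter.Tendsto (fun k => ((ρ' - ρ k) 1).re) Filter.atTop (nhds 0) := by
    simpa [Function.comp_def] using (Complex.continuous_re.tendsto _).comp ((hconv 1).const_sub (ρ' 1))
  exact squeeze_zero (fun _ => norm_nonneg _)
    (fun k => (ρ' - ρ k).opNorm_le_re_apply_one_of_nonneg (hpos k)) h_one
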